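/- arXiv:2206.05325 — 2 statements merged into one kernel-verified Lean document; each statement's English description precedes it below -/
import Mathlib

section
/- Let f : ℝ³ → ℝ be C^∞, let S := f⁻¹({0}) be nonempty and compact, and assume ∇f(y) ≠ 0 for every y ∈ S. Then there exists ε > 0 such that every x ∈ ℝ³ with dist(x,S) < ε has a unique nearest point in S: there is exactly one y ∈ S with |x − y| = dist(x,S). -/
open MeasureTheory Set Filter Metric
open scoped Topology

noncomputable section

abbrev E3 : Type := EuclideanSpace ℝ (Fin 3)

/-- A nearest point `y` of a regular level set satisfies the Lagrange condition: `x - y` is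
proportional to the derivative of `f` at `y`. -/
theorem exists_inner_eq_mul_fderiv_of_nearest {E : Type*} [NormedAddCommGroup E]
    [InnerProductSpace ℝ E] [CompleteSpace E] {f : E → ℝ} {x y : E}
    (hf : HasStrictFDerivAt f (fderiv ℝ f y) y) (hy : fderiv ℝ f y ≠ 0)
    (hmin : ∀ z, f z = f y → dist x y ≤ dist x z) :
    ∃ t : ℝ, ∀ w, inner ℝ (x - y) w = t * fderiv ℝ f y w := by
  have hφ : HasStrictFDerivAt (fun z : E => ‖z - x‖ ^ 2)
      (2 • (innerSL ℝ (y - x)).comp (ContinuousLinearMap.id ℝ E)) y :=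
    (hasStrictFDerivAt_norm_sq (y - x)).comp y ((hasStrictFDerivAt_id y).sub_const x)
  have hext : IsLocalExtrOn (fun z : E => ‖z - x‖ ^ 2) {z | f z = f y} y := by
    refine Or.inl (IsMinOn.localize fun z hz => ?_)
    have h := hmin z hz
    rw [dist_comm x y, dist_comm x z, dist_eq_norm, dist_eq_norm] at h
    exact pow_le_pow_left₀ (norm_nonneg _) h 2
  obtain ⟨a, b, hab, h⟩ := hext.exists_multipliers_of_hasStrictFDerivAt_1d hf hφ
  have hw (w : E) : a * fderiv ℝ f y w + b * (2 * inner ℝ (y - x) w) = 0 := by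
    simpa [inner_sub_left] using DFunLike.congr_fun h w
  have hb : b ≠ 0 := by
    rintro rfl
    have ha : a ≠ 0 := fun ha => hab (by simp [ha])
    exact hy (ContinuousLinearMap.ext fun w => by simpa [ha] using hw w)
  refine ⟨a / (2 * b), fun w => ?_⟩
  have h1 : inner ℝ (y - x) w = -inner ℝ (x - y) w := by
    rw [← neg_sub x y, inner_neg_left]
  have h2 := hw w
  rw [h1] at h2
  field_simp
  linarith

/-- First-order Taylor estimate on a compact convex set, with a uniform quadratic remainder. -/
theorem exists_norm_sub_fderiv_le_mul_sq {E : Type*} [NormedAddCommGroup E]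
    [NormedSpace ℝ E] {f : E → ℝ} (hf : ContDiff ℝ 2 f) {B : Set E} (hB : IsCompact B)
    (hconv : Convex ℝ B) :
    ∃ K : ℝ, 0 < K ∧ ∀ y ∈ B, ∀ z ∈ B,
      ‖f z - f y - fderiv ℝ f y (z - y)‖ ≤ K * ‖z - y‖ ^ 2 := by
  have hf' : ContDiff ℝ 1 (fderiv ℝ f) := hf.fderiv_right (by norm_num)
  obtain ⟨C, hC⟩ := hB.exists_bound_of_continuousOn
    (hf'.continuous_fderiv one_ne_zero).continuousOn
  refine ⟨|C| + 1, by positivity, fun y hy z hz => ?_⟩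
  have hsub : segment ℝ y z ⊆ B := hconv.segment_subset hy hz
  have hlip : ∀ u ∈ segment ℝ y z,
      ‖fderiv ℝ f u - fderiv ℝ f y‖ ≤ (|C| + 1) * ‖z - y‖ := fun u hu => by
    refine (hconv.norm_image_sub_le_of_norm_fderiv_le (C := |C| + 1)
      (fun v _ => (hf'.differentiable one_ne_zero) v)
      (fun v hv => (hC v hv).trans ((le_abs_self C).trans (by linarith))) hy (hsub hu)).trans ?_
    refine mul_le_mul_of_nonneg_left ?_ (by positivity)
    obtain ⟨s, ⟨hs0, hs1⟩, rfl⟩ := (segment_eq_image' ℝ y z) ▸ hu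
    rw [add_sub_cancel_left, norm_smul, Real.norm_of_nonneg hs0]
    exact mul_le_of_le_one_left (norm_nonneg _) hs1
  have h := (convex_segment y z).norm_image_sub_le_of_norm_fderiv_le'
    (fun v _ => (hf.differentiable two_ne_zero) v) hlip
    (left_mem_segment ℝ y z) (right_mem_segment ℝ y z)
  linarith

/-- unique nearest point property of a tube around a compact regular
level set. If `S = f⁻¹(0)` is a nonempty compact regular level set of a `C^∞` function
`f : ℝ³ → ℝ`, then there is `ε > 0` such that every point `x` with `dist(x,S) < ε` has a
unique nearest point in `S`. -/
theorem statement15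
    (f : E3 → ℝ) (hf : ContDiff ℝ (⊤ : ℕ∞) f)
    (hne : (f ⁻¹' {0}).Nonempty) (hcpt : IsCompact (f ⁻¹' {0}))
    (hreg : ∀ y ∈ f ⁻¹' {0}, fderiv ℝ f y ≠ 0) :
    ∃ ε : ℝ, 0 < ε ∧ ∀ x : E3, Metric.infDist x (f ⁻¹' {0}) < ε →
      ∃! y : E3, y ∈ f ⁻¹' {0} ∧ dist x y = Metric.infDist x (f ⁻¹' {0}) := by
  have hf2 : ContDiff ℝ 2 f := hf.of_le (WithTop.coe_le_coe.2 le_top)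
  obtain ⟨R, hR⟩ := hcpt.isBounded.subset_closedBall 0
  obtain ⟨K, hK, hTaylor⟩ := exists_norm_sub_fderiv_le_mul_sq hf2
    (isCompact_closedBall (0 : E3) R) (convex_closedBall _ _)
  obtain ⟨p, hp, hpmin⟩ := hcpt.exists_isMinOn hne
    (hf2.continuous_fderiv two_ne_zero).norm.continuousOn
  set c := ‖fderiv ℝ f p‖
  have hc : 0 < c := norm_pos_iff.2 (hreg p hp)
  refine ⟨c / (2 * K), by positivity, fun x hx => ?_⟩
  obtain ⟨y, hy, hxy⟩ := hcpt.exists_infDist_eq_dist hne x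
  refine ⟨y, ⟨hy, hxy.symm⟩, fun z hz => ?_⟩
  obtain ⟨hzS, hxz⟩ := hz
  have hfy : f y = 0 := hy
  have hfz : f z = 0 := hzS
  obtain ⟨t, ht⟩ := exists_inner_eq_mul_fderiv_of_nearest
    (hf2.contDiffAt.hasStrictFDerivAt two_ne_zero) (hreg y hy) (x := x) fun u hu => by
      rw [← hxy]
      exact infDist_le_dist_of_mem (show f u = 0 from hu.trans hfy)
  have htc : |t| * c ≤ dist x y := by
    refine (mul_le_mul_of_nonneg_left (hpmin hy) (abs_nonneg t)).trans ?_
    rw [← Real.norm_eq_abs, ← norm_smul, dist_eq_norm]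
    refine ContinuousLinearMap.opNorm_le_bound _ (norm_nonneg _) fun w => ?_
    rw [smul_apply, smul_eq_mul, ← ht w]
    exact norm_inner_le_norm _ _
  have hT := hTaylor y (hR hy) z (hR hzS)
  rw [hfy, hfz, sub_zero, zero_sub, norm_neg, Real.norm_eq_abs] at hT
  have hsq : ‖z - y‖ ^ 2 = 2 * (t * fderiv ℝ f y (z - y)) := by
    have hd : ‖(x - y) - (z - y)‖ = ‖x - y‖ := by
      rw [sub_sub_sub_cancel_right, ← dist_eq_norm, ← dist_eq_norm, hxz, hxy]
    have hexp := norm_sub_sq_real (x - y) (z - y)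
    rw [hd, ht] at hexp
    linarith
  have hle : ‖z - y‖ ^ 2 ≤ 2 * (|t| * (K * ‖z - y‖ ^ 2)) := by
    calc ‖z - y‖ ^ 2 = 2 * (t * fderiv ℝ f y (z - y)) := hsq
      _ ≤ 2 * (|t| * |fderiv ℝ f y (z - y)|) := by
        rw [← abs_mul]
        gcongr
        exact le_abs_self _
      _ ≤ _ := by gcongr
  have hsmall : 2 * |t| * K < 1 := by
    rw [hxy, lt_div_iff₀ (by positivity)] at hx
    have : |t| * c * (2 * K) < c :=
      (mul_le_mul_of_nonneg_right htc (by positivity)).trans_lt hx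
    nlinarith
  have hzero : ‖z - y‖ ^ 2 = 0 := by
    nlinarith [sq_nonneg ‖z - y‖]
  exact sub_eq_zero.1 (norm_eq_zero.1 (pow_eq_zero_iff two_ne_zero |>.1 hzero))
end
end

section
/- Let f : ℝ³ → ℝ be C^∞, let S := f⁻¹({0}) be nonempty and compact, and assume ∇f(y) ≠ 0 for every y ∈ S. Then there exists ε > 0 such that, denoting by π(x) the unique nearest point of S to x for x in the open tube U_ε := {x ∈ ℝ³ : dist(x,S) < ε}: (a) the projection map π is C^∞ on U_ε; (b) the distance function x ↦ dist(x,S) is C^∞ on U_ε \ S, and its gradient there is ∇dist(x,S) = (x − π(x))/dist(x,S), which is a unit vector. -/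
open MeasureTheory Set Filter Metric
open scoped Topology

noncomputable section

open scoped RealInnerProductSpace

theorem ContDiff.exists_openPartialHomeomorph_contDiffAt_symm
    {E F : Type*} [NormedAddCommGroup E] [NormedSpace ℝ E] [CompleteSpace E]
    [NormedAddCommGroup F] [NormedSpace ℝ F] {Φ : E → F} (hΦ : ContDiff ℝ (⊤ : ℕ∞) Φ) {a : E}
    {A : E ≃L[ℝ] F} (hA : HasFDerivAt Φ (A : E →L[ℝ] F) a) :
    ∃ e : OpenPartialHomeomorph E F, a ∈ e.source ∧ ⇑e = Φ ∧
      ∀ y ∈ e.target, ContDiffAt ℝ (⊤ : ℕ∞) e.symm y := by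
  set s : Set E := fderiv ℝ Φ ⁻¹' range ((↑) : (E ≃L[ℝ] F) → E →L[ℝ] F)
  have hso : IsOpen s :=
    ContinuousLinearEquiv.isOpen.preimage (hΦ.continuous_fderiv (by simp))
  have has : a ∈ s := ⟨A, hA.fderiv.symm⟩
  have hn : ((⊤ : ℕ∞) : WithTop ℕ∞) ≠ 0 := by simp
  set e := hΦ.contDiffAt.toOpenPartialHomeomorph Φ hA hn
  have hae : a ∈ e.source := hΦ.contDiffAt.mem_toOpenPartialHomeomorph_source hA hn
  refine ⟨e.restrOpen s hso, by simpa using ⟨hae, has⟩, rfl, fun y hy => ?_⟩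
  have hmem := (e.restrOpen s hso).map_target hy
  rw [OpenPartialHomeomorph.restrOpen_source] at hmem
  obtain ⟨B, hB⟩ := hmem.2
  refine (e.restrOpen s hso).contDiffAt_symm (f₀' := B) hy ?_ hΦ.contDiffAt
  rw [hB]
  exact (hΦ.differentiable (by simp)).differentiableAt.hasFDerivAt

variable {E : Type*} [NormedAddCommGroup E] [InnerProductSpace ℝ E]

theorem ContDiff.gradient [CompleteSpace E] {f : E → ℝ} (hf : ContDiff ℝ (⊤ : ℕ∞) f) :
    ContDiff ℝ (⊤ : ℕ∞) (gradient f) := by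
  have hf' : ContDiff ℝ (⊤ : ℕ∞) (fderiv ℝ f) := hf.fderiv_right (by simp)
  let L : StrongDual ℝ E →L[ℝ] E :=
    { toFun := (InnerProductSpace.toDual ℝ E).symm
      map_add' := map_add _
      map_smul' := fun c x => by simp
      cont := (InnerProductSpace.toDual ℝ E).symm.continuous }
  exact L.contDiff.comp hf'

theorem gradient_ne_zero [CompleteSpace E] {f : E → ℝ} {y : E} (h : fderiv ℝ f y ≠ 0) :
    gradient f y ≠ 0 := fun h0 => h <| by rw [← toDual_gradient, h0, map_zero]

/-- The endpoint map of the normal flow to the level sets of `f`, paired with the level. -/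
def normalMap [CompleteSpace E] (f : E → ℝ) (p : E × ℝ) : E × ℝ :=
  (p.1 + p.2 • gradient f p.1, f p.1)

theorem contDiff_normalMap [CompleteSpace E] {f : E → ℝ} (hf : ContDiff ℝ (⊤ : ℕ∞) f) :
    ContDiff ℝ (⊤ : ℕ∞) (normalMap f) :=
  (contDiff_fst.add (contDiff_snd.smul (hf.gradient.comp contDiff_fst))).prodMk
    (hf.comp contDiff_fst)

theorem exists_hasFDerivAt_normalMap [FiniteDimensional ℝ E] {f : E → ℝ}
    (hf : ContDiff ℝ (⊤ : ℕ∞) f) {y : E} (hy : fderiv ℝ f y ≠ 0) :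
    ∃ A : (E × ℝ) ≃L[ℝ] (E × ℝ), HasFDerivAt (normalMap f) (A : (E × ℝ) →L[ℝ] (E × ℝ)) (y, 0) := by
  have hg : HasFDerivAt (gradient f) (fderiv ℝ (gradient f) y) ((y, 0) : E × ℝ).1 :=
    (hf.gradient.differentiable (by simp)).differentiableAt.hasFDerivAt
  have hff : HasFDerivAt f (fderiv ℝ f y) ((y, 0) : E × ℝ).1 :=
    (hf.differentiable (by simp)).differentiableAt.hasFDerivAt
  have h1 := ((hasFDerivAt_fst (𝕜 := ℝ) (p := ((y, 0) : E × ℝ))).add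
    ((hasFDerivAt_snd (𝕜 := ℝ) (p := ((y, 0) : E × ℝ))).smul (hg.comp _ hasFDerivAt_fst))).prodMk
      (hff.comp _ hasFDerivAt_fst)
  set B := fderiv ℝ (normalMap f) (y, 0)
  have hBd : HasFDerivAt (normalMap f) B (y, 0) :=
    ((contDiff_normalMap hf).differentiable (by simp)).differentiableAt.hasFDerivAt
  have hBapp (v : E) (s : ℝ) : B (v, s) = (v + s • gradient f y, fderiv ℝ f y v) := by
    rw [hBd.unique h1]
    simp
  have hinj : Function.Injective B := by
    rw [injective_iff_map_eq_zero]
    rintro ⟨v, s⟩ h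
    rw [hBapp, Prod.mk_eq_zero] at h
    have hv : v = -(s • gradient f y) := eq_neg_of_add_eq_zero_left h.1
    have hs : s = 0 := by
      have h2 := h.2
      rw [hv, ← inner_gradient_left, inner_neg_right, inner_smul_right,
        real_inner_self_eq_norm_sq] at h2
      simpa [gradient_ne_zero hy] using h2
    simp [hv, hs]
  refine ⟨(LinearEquiv.ofInjectiveEndo (B : (E × ℝ) →ₗ[ℝ] (E × ℝ)) hinj).toContinuousLinearEquiv,
    ?_⟩
  convert hBd
  ext <;> rfl

theorem hasStrictFDerivAt_norm_sub_sq (p x : E) :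
    HasStrictFDerivAt (fun z => ‖z - p‖ ^ 2) (2 • innerSL ℝ (x - p)) x := by
  simpa using (hasStrictFDerivAt_norm_sq (x - p)).comp x
    ((hasStrictFDerivAt_id (𝕜 := ℝ) x).sub_const p)

/-- Lagrange condition for a nearest point of a regular level set. -/
theorem exists_smul_gradient_eq_sub [FiniteDimensional ℝ E] {f : E → ℝ}
    (hf : ContDiff ℝ (⊤ : ℕ∞) f) {x y : E} (hyS : f y = 0) (hy : fderiv ℝ f y ≠ 0)
    (hmin : ∀ z, f z = 0 → dist x y ≤ dist x z) : ∃ t : ℝ, x - y = t • gradient f y := by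
  have hext : IsLocalExtrOn (fun z => ‖z - x‖ ^ 2) {z | f z = f y} y := by
    refine Or.inl (IsMinOn.localize fun z hz => ?_)
    have := hmin z (hz.trans hyS)
    rw [dist_comm x y, dist_comm x z, dist_eq_norm, dist_eq_norm] at this
    simp only [mem_ofPred_eq]
    gcongr
  obtain ⟨a, b, hab, h⟩ := hext.exists_multipliers_of_hasStrictFDerivAt_1d
    (hf.contDiffAt.hasStrictFDerivAt (by simp)) (hasStrictFDerivAt_norm_sub_sq x y)
  have hb : b ≠ 0 := by
    rintro rfl
    simp only [zero_smul, add_zero, smul_eq_zero, hy, or_false] at h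
    simp [h] at hab
  have key : a • gradient f y + (2 * b) • (y - x) = 0 := by
    refine ext_inner_right ℝ fun v => ?_
    have := DFunLike.congr_fun h v
    simp only [add_apply, smul_apply, innerSL_apply_apply, zero_apply,
      nsmul_eq_mul, smul_eq_mul, Nat.cast_ofNat] at this
    rw [inner_add_left, real_inner_smul_left, real_inner_smul_left, inner_gradient_left,
      inner_zero_left]
    linarith
  refine ⟨a / (2 * b), ?_⟩
  rw [div_eq_inv_mul, mul_smul, eq_inv_smul_iff₀ (by simpa using hb), ← sub_eq_zero,
    ← neg_eq_zero, ← key]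
  module

/-- A smooth map which locally picks every nearest point of a regular level set. -/
theorem eventually_exists_contDiffAt_nearest [FiniteDimensional ℝ E] {f : E → ℝ}
    (hf : ContDiff ℝ (⊤ : ℕ∞) f) (hreg : ∀ y ∈ f ⁻¹' {0}, fderiv ℝ f y ≠ 0)
    {y₀ : E} (hy₀ : y₀ ∈ f ⁻¹' {0}) :
    ∀ᶠ x in 𝓝 y₀, ∃ g : E → E, ContDiffAt ℝ (⊤ : ℕ∞) g x ∧
      ∀ᶠ z in 𝓝 x, ∀ y ∈ f ⁻¹' {0}, dist z y = infDist z (f ⁻¹' {0}) → y = g z := by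
  obtain ⟨A, hA⟩ := exists_hasFDerivAt_normalMap hf (hreg y₀ hy₀)
  obtain ⟨e, hae, he, hsmooth⟩ :=
    (contDiff_normalMap hf).exists_openPartialHomeomorph_contDiffAt_symm hA
  have hval : normalMap f (y₀, 0) = (y₀, 0) := by
    simpa [normalMap] using hy₀
  have htgt : (y₀, (0 : ℝ)) ∈ e.target := by
    simpa [he, hval] using e.map_source hae
  let T : E × E → E × ℝ := fun p =>
    (p.2, ⟪gradient f p.2, p.1 - p.2⟫ / ‖gradient f p.2‖ ^ 2)
  have hT : ContinuousAt T (y₀, y₀) := by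
    have hgc := hf.gradient.continuous
    refine ContinuousAt.prodMk continuousAt_snd (ContinuousAt.div ?_ ?_ ?_)
    · fun_prop
    · fun_prop
    · simpa using gradient_ne_zero (hreg y₀ hy₀)
  have hTs : T ⁻¹' e.source ∈ 𝓝 (y₀, y₀) :=
    hT.preimage_mem_nhds (e.open_source.mem_nhds (by simpa [T] using hae))
  obtain ⟨δ, hδ, hball⟩ := Metric.mem_nhds_iff.1 hTs
  have hnear : ∀ z ∈ ball y₀ (δ / 2), ∀ y ∈ f ⁻¹' {0},
      dist z y = infDist z (f ⁻¹' {0}) → y = (e.symm (z, 0)).1 := by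
    intro z hz y hy hzy
    rw [mem_ball] at hz
    have hle : dist z y ≤ dist z y₀ := hzy.trans_le (infDist_le_dist_of_mem hy₀)
    have hyy : dist y y₀ < δ := by
      have := dist_triangle_left y y₀ z
      linarith
    have hsrc : T (z, y) ∈ e.source := hball (by
      rw [mem_ball, Prod.dist_eq]
      exact max_lt (by dsimp only; linarith) hyy)
    obtain ⟨t, ht⟩ := exists_smul_gradient_eq_sub hf (x := z) hy (hreg y hy)
      fun w hw => hzy.trans_le (infDist_le_dist_of_mem hw)
    have hTt : T (z, y) = (y, t) := by
      have := gradient_ne_zero (hreg y hy)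
      simp only [T, ht, inner_smul_right, real_inner_self_eq_norm_sq]
      field_simp
    have hez : e (y, t) = (z, 0) := by
      rw [he, normalMap, ← ht, add_sub_cancel, show f y = 0 from hy]
    rw [← hez, e.left_inv (hTt ▸ hsrc)]
  have htgt' : ∀ᶠ x in 𝓝 y₀, (x, (0 : ℝ)) ∈ e.target :=
    (Continuous.prodMk_left (0 : ℝ)).continuousAt.preimage_mem_nhds (e.open_target.mem_nhds htgt)
  filter_upwards [htgt', ball_mem_nhds y₀ (half_pos hδ)] with x hx hxb
  refine ⟨fun z => (e.symm (z, 0)).1, ?_, ?_⟩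
  · exact ((hsmooth _ hx).comp x (contDiffAt_id.prodMk contDiffAt_const)).fst
  · filter_upwards [isOpen_ball.mem_nhds hxb] with z hz using hnear z hz

theorem gradient_infDist_of_dist_eq [CompleteSpace E] {S : Set E} {x p : E} (hp : p ∈ S)
    (hxp : dist x p = infDist x S) (hpos : 0 < infDist x S)
    (hd : DifferentiableAt ℝ (fun z => infDist z S) x) :
    gradient (fun z => infDist z S) x = (infDist x S)⁻¹ • (x - p) := by
  have h2 := (hasStrictFDerivAt_norm_sub_sq p x).hasFDerivAt.sub (hd.hasFDerivAt.pow 2)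
  have hmin : IsLocalMin ((fun z => ‖z - p‖ ^ 2) - (fun z => infDist z S) ^ 2) x := by
    refine Eventually.of_forall fun z => ?_
    have hz : infDist z S ≤ ‖z - p‖ := by
      rw [← dist_eq_norm]
      exact infDist_le_dist_of_mem hp
    simp only [Pi.sub_apply, Pi.pow_apply, ← dist_eq_norm, hxp, sub_self, sub_nonneg]
    rw [dist_eq_norm]
    exact pow_le_pow_left₀ infDist_nonneg hz 2
  have h0 := hmin.hasFDerivAt_eq_zero h2
  refine ext_inner_right ℝ fun v => ?_
  rw [inner_gradient_left, real_inner_smul_left, eq_inv_mul_iff_mul_eq₀ hpos.ne']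
  have := DFunLike.congr_fun h0 v
  simp only [sub_apply, smul_apply, innerSL_apply_apply, zero_apply, nsmul_eq_mul, smul_eq_mul,
    Nat.cast_ofNat, Nat.add_one_sub_one, pow_one] at this
  linarith

/-- regularity of the nearest-point projection and of the distance
function on a tube around a compact regular level set. With `S = f⁻¹(0)` a nonempty
compact regular level set of a `C^∞` function `f : ℝ³ → ℝ`, there are `ε > 0` and a map
`π` such that on the tube `U_ε = {dist(·,S) < ε}`: `π x` is the unique nearest point of
`S` to `x`, `π` is `C^∞` on `U_ε`, the distance function is `C^∞` on `U_ε \ S`, and there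
its gradient is the unit vector `(x − π x)/dist(x,S)`. -/
theorem statement16
    (f : E3 → ℝ) (hf : ContDiff ℝ (⊤ : ℕ∞) f)
    (hne : (f ⁻¹' {0}).Nonempty) (hcpt : IsCompact (f ⁻¹' {0}))
    (hreg : ∀ y ∈ f ⁻¹' {0}, fderiv ℝ f y ≠ 0) :
    ∃ ε : ℝ, 0 < ε ∧ ∃ π : E3 → E3,
      (∀ x : E3, Metric.infDist x (f ⁻¹' {0}) < ε →
        π x ∈ f ⁻¹' {0} ∧ dist x (π x) = Metric.infDist x (f ⁻¹' {0}) ∧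
        ∀ y ∈ f ⁻¹' {0}, dist x y = Metric.infDist x (f ⁻¹' {0}) → y = π x) ∧
      ContDiffOn ℝ (⊤ : ℕ∞) π {x : E3 | Metric.infDist x (f ⁻¹' {0}) < ε} ∧
      ContDiffOn ℝ (⊤ : ℕ∞) (fun x : E3 => Metric.infDist x (f ⁻¹' {0}))
        ({x : E3 | Metric.infDist x (f ⁻¹' {0}) < ε} \ f ⁻¹' {0}) ∧
      ∀ x ∈ ({x : E3 | Metric.infDist x (f ⁻¹' {0}) < ε} \ f ⁻¹' {0}),
        gradient (fun x : E3 => Metric.infDist x (f ⁻¹' {0})) x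
            = (Metric.infDist x (f ⁻¹' {0}))⁻¹ • (x - π x) ∧
          ‖gradient (fun x : E3 => Metric.infDist x (f ⁻¹' {0})) x‖ = 1 := by
  have hclosed : IsClosed (f ⁻¹' {0}) := hcpt.isClosed
  set S := f ⁻¹' {0}
  obtain ⟨ε, hε, hsub⟩ := (Metric.mem_nhdsSet_iff hcpt).1 (mem_nhdsSet_iff_forall.2 fun y hy =>
    eventually_exists_contDiffAt_nearest hf hreg hy)
  choose π hπS hπd using fun x => hcpt.exists_infDist_eq_dist hne x
  have htube : IsOpen {x : E3 | infDist x S < ε} :=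
    isOpen_lt (continuous_infDist_pt S) continuous_const
  have hlocal : ∀ x : E3, infDist x S < ε → ContDiffAt ℝ (⊤ : ℕ∞) π x ∧
      ∀ y ∈ S, dist x y = infDist x S → y = π x := by
    intro x hx
    obtain ⟨g, hg, hgev⟩ := hsub ((mem_thickening_iff_infDist_lt hne).2 hx)
    have hπg : π =ᶠ[𝓝 x] g := by
      filter_upwards [hgev] with z hz using hz _ (hπS z) (hπd z).symm
    exact ⟨hg.congr_of_eventuallyEq hπg, fun y hy hxy =>
      (hgev.self_of_nhds y hy hxy).trans hπg.eq_of_nhds.symm⟩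
  have hpos : ∀ x ∉ S, 0 < infDist x S := fun x => (hclosed.notMem_iff_infDist_pos hne).1
  have hdist : ∀ x ∈ {x : E3 | infDist x S < ε} \ S,
      ContDiffAt ℝ (⊤ : ℕ∞) (fun x => infDist x S) x := by
    rintro x ⟨hx, hxS⟩
    have heq : (fun x => infDist x S) = fun x => ‖x - π x‖ := by
      ext z
      rw [hπd, dist_eq_norm]
    rw [heq]
    refine (contDiffAt_id.sub (hlocal x hx).1).norm ℝ ?_
    have := hpos x hxS
    rw [hπd] at this
    exact sub_ne_zero.2 (dist_pos.1 this)
  refine ⟨ε, hε, π, fun x hx => ⟨hπS x, (hπd x).symm, (hlocal x hx).2⟩,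
    fun x hx => (hlocal x hx).1.contDiffWithinAt, fun x hx => (hdist x hx).contDiffWithinAt,
    fun x hx => ?_⟩
  have hgrad := gradient_infDist_of_dist_eq (hπS x) (hπd x).symm (hpos x hx.2)
    ((hdist x hx).differentiableAt (by simp))
  refine ⟨hgrad, ?_⟩
  rw [hgrad, norm_smul, norm_inv, Real.norm_of_nonneg infDist_nonneg, ← dist_eq_norm, ← hπd]
  exact inv_mul_cancel₀ (hpos x hx.2).ne'
end
end
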